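/- There exist 𝕂(q)-algebra homomorphisms Δ: U → U ⊗ U and ε: U → 𝕂(q), and a 𝕂(q)-algebra antihomomorphism S: U → U, satisfying for 1 ≤ i ≤ n: Δ(X_i) = X_i ⊗ X_i, Δ(Y_i) = (Y_i - 1) ⊗ X_i^{-1} + 1 ⊗ Y_i, Δ(Z_i) = (Z_i - 1) ⊗ X_i^{-1} + 1 ⊗ Z_i; ε(X_i) = ε(Y_i) = ε(Z_i) = 1; S(X_i) = X_i^{-1}, S(Y_i) = 1 + X_i - Y_iX_i, S(Z_i) = 1 + X_i - Z_iX_i; moreover, under the isomorphism θ: U → U_q(g) given by θ(X_i^{±1}) = K_i^{±1}, θ(Y_i) = K_i^{-1} + F_i(q_i - q_i^{-1}), θ(Z_i) = K_i^{-1} - K_i^{-1}E_i q_i(q_i - q_i^{-1}), these maps correspond to the standard comultiplication, counit, and antipode of U_q(g) determined by Δ_std(E_i) = E_i ⊗ 1 + K_i ⊗ E_i, Δ_std(F_i) = F_i ⊗ K_i^{-1} + 1 ⊗ F_i, Δ_std(K_i) = K_i ⊗ K_i, ε_std(E_i) = ε_std(F_i) = 0, ε_std(K_i) = 1, S_std(E_i)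 = -K_i^{-1}E_i, S_std(F_i) = -F_iK_i, S_std(K_i) = K_i^{-1}. -/

import Mathlib

open FreeAlgebra
open scoped TensorProduct

noncomputable section

/-- The field `𝕂(q)` of rational functions in the indeterminate `q` over `𝕂`. -/
abbrev Kq (K : Type) [Field K] : Type := RatFunc K

/-- The indeterminate `q` viewed as an element of `𝕂(q)`. -/
def qv (K : Type) [Field K] : Kq K := RatFunc.X

/-- `q_i = q^{d_i}`, given the exponent `di = d_i`. -/
def qi (K : Type) [Field K] (di : ℕ) : Kq K := qv K ^ di

/-- The quantum integer `[m]_i = (q_i^m - q_i^{-m})/(q_i - q_i⁻¹)`. -/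
def qnum (K : Type) [Field K] (di : ℕ) (m : ℤ) : Kq K :=
  (qi K di ^ m - qi K di ^ (-m)) / (qi K di - (qi K di)⁻¹)

/-- The quantum factorial `[m]_i! = [m]_i [m-1]_i ⋯ [1]_i`, with `[0]_i! = 1`. -/
def qfac (K : Type) [Field K] (di : ℕ) : ℕ → Kq K
  | 0 => 1
  | m + 1 => qnum K di (m + 1) * qfac K di m

/-- The Gaussian binomial coefficient `[m choose r]_i = [m]_i!/([r]_i![m-r]_i!)`. -/
def qbin (K : Type) [Field K] (di m r : ℕ) : Kq K :=
  qfac K di m / (qfac K di r * qfac K di (m - r))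

/-- Chevalley generators `E_i, F_i, K_i, K_i⁻¹` of `U_q(g)`. -/
inductive CGen (n : ℕ) : Type
  | E : Fin n → CGen n
  | F : Fin n → CGen n
  | K : Fin n → CGen n
  | Kinv : Fin n → CGen n

/-- The defining relations (R1)–(R7) of `U_q(g)` in the Chevalley presentation. -/
inductive CRel (K : Type) [Field K] {n : ℕ} (A : Matrix (Fin n) (Fin n) ℤ) (d : Fin n → ℕ) :
    FreeAlgebra (Kq K) (CGen n) → FreeAlgebra (Kq K) (CGen n) → Prop
  | R1a (i : Fin n) : CRel K A d (ι (Kq K) (CGen.K i) * ι (Kq K) (CGen.Kinv i)) 1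
  | R1b (i : Fin n) : CRel K A d (ι (Kq K) (CGen.Kinv i) * ι (Kq K) (CGen.K i)) 1
  | R2 (i j : Fin n) : CRel K A d (ι (Kq K) (CGen.K i) * ι (Kq K) (CGen.K j))
      (ι (Kq K) (CGen.K j) * ι (Kq K) (CGen.K i))
  | R3 (i j : Fin n) : CRel K A d
      (ι (Kq K) (CGen.K i) * ι (Kq K) (CGen.E j) * ι (Kq K) (CGen.Kinv i))
      (qi K (d i) ^ (A i j) • ι (Kq K) (CGen.E j))
  | R4 (i j : Fin n) : CRel K A d
      (ι (Kq K) (CGen.K i) * ι (Kq K) (CGen.F j) * ι (Kq K) (CGen.Kinv i))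
      (qi K (d i) ^ (-(A i j)) • ι (Kq K) (CGen.F j))
  | R5 (i j : Fin n) : CRel K A d
      (ι (Kq K) (CGen.E i) * ι (Kq K) (CGen.F j) - ι (Kq K) (CGen.F j) * ι (Kq K) (CGen.E i))
      (if i = j then (qi K (d i) - (qi K (d i))⁻¹)⁻¹ •
        (ι (Kq K) (CGen.K i) - ι (Kq K) (CGen.Kinv i)) else 0)
  | R6 (i j : Fin n) (hij : i ≠ j) : CRel K A d
      (∑ r ∈ Finset.range ((1 - A i j).toNat + 1),
        ((-1 : Kq K) ^ r * qbin K (d i) (1 - A i j).toNat r) •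
          (ι (Kq K) (CGen.E i) ^ ((1 - A i j).toNat - r) * ι (Kq K) (CGen.E j) *
            ι (Kq K) (CGen.E i) ^ r)) 0
  | R7 (i j : Fin n) (hij : i ≠ j) : CRel K A d
      (∑ r ∈ Finset.range ((1 - A i j).toNat + 1),
        ((-1 : Kq K) ^ r * qbin K (d i) (1 - A i j).toNat r) •
          (ι (Kq K) (CGen.F i) ^ ((1 - A i j).toNat - r) * ι (Kq K) (CGen.F j) *
            ι (Kq K) (CGen.F i) ^ r)) 0

/-- The quantum group `U_q(g)` presented by generators and relations (R1)–(R7). -/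
abbrev Uqg (K : Type) [Field K] {n : ℕ} (A : Matrix (Fin n) (Fin n) ℤ) (d : Fin n → ℕ) :=
  RingQuot (CRel K A d)

variable (K : Type) [Field K] {n : ℕ} (A : Matrix (Fin n) (Fin n) ℤ) (d : Fin n → ℕ)

def genE (i : Fin n) : Uqg K A d := RingQuot.mkAlgHom (Kq K) (CRel K A d) (ι (Kq K) (CGen.E i))
def genF (i : Fin n) : Uqg K A d := RingQuot.mkAlgHom (Kq K) (CRel K A d) (ι (Kq K) (CGen.F i))
def genK (i : Fin n) : Uqg K A d := RingQuot.mkAlgHom (Kq K) (CRel K A d) (ι (Kq K) (CGen.K i))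
def genKinv (i : Fin n) : Uqg K A d :=
  RingQuot.mkAlgHom (Kq K) (CRel K A d) (ι (Kq K) (CGen.Kinv i))

/-- Equitable generators `X_i, X_i⁻¹, Y_i, Z_i`. -/
inductive EGen (n : ℕ) : Type
  | X : Fin n → EGen n
  | Xinv : Fin n → EGen n
  | Y : Fin n → EGen n
  | Z : Fin n → EGen n

/-- The defining relations (E1)–(E8) of the equitable presentation. -/
inductive ERel (K : Type) [Field K] {n : ℕ} (A : Matrix (Fin n) (Fin n) ℤ) (d : Fin n → ℕ) :
    FreeAlgebra (Kq K) (EGen n) → FreeAlgebra (Kq K) (EGen n) → Prop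
  | E1a (i : Fin n) : ERel K A d (ι (Kq K) (EGen.X i) * ι (Kq K) (EGen.Xinv i)) 1
  | E1b (i : Fin n) : ERel K A d (ι (Kq K) (EGen.Xinv i) * ι (Kq K) (EGen.X i)) 1
  | E2 (i j : Fin n) : ERel K A d (ι (Kq K) (EGen.X i) * ι (Kq K) (EGen.X j))
      (ι (Kq K) (EGen.X j) * ι (Kq K) (EGen.X i))
  | E3 (i j : Fin n) : ERel K A d
      (ι (Kq K) (EGen.Y i) * ι (Kq K) (EGen.X j) -
        qi K (d i) ^ (A i j) • (ι (Kq K) (EGen.X j) * ι (Kq K) (EGen.Y i)))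
      ((1 - qi K (d i) ^ (A i j)) • (ι (Kq K) (EGen.Xinv i) * ι (Kq K) (EGen.X j)))
  | E4 (i j : Fin n) : ERel K A d
      (ι (Kq K) (EGen.X i) * ι (Kq K) (EGen.Z j) -
        qi K (d i) ^ (A i j) • (ι (Kq K) (EGen.Z j) * ι (Kq K) (EGen.X i)))
      ((1 - qi K (d i) ^ (A i j)) • (ι (Kq K) (EGen.X i) * ι (Kq K) (EGen.Xinv j)))
  | E5 (i : Fin n) : ERel K A d
      (ι (Kq K) (EGen.Z i) * ι (Kq K) (EGen.Y i) -
        (qi K (d i) ^ 2) • (ι (Kq K) (EGen.Y i) * ι (Kq K) (EGen.Z i)))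
      ((1 - qi K (d i) ^ 2) • 1)
  | E6 (i j : Fin n) (hij : i ≠ j) : ERel K A d
      (ι (Kq K) (EGen.Z i) * ι (Kq K) (EGen.Y j) -
        qi K (d i) ^ (A i j) • (ι (Kq K) (EGen.Y j) * ι (Kq K) (EGen.Z i)))
      ((1 - qi K (d i) ^ (A i j)) • (ι (Kq K) (EGen.Xinv i) * ι (Kq K) (EGen.Xinv j)))
  | E7 (i j : Fin n) (hij : i ≠ j) : ERel K A d
      (∑ r ∈ Finset.range ((1 - A i j).toNat + 1),
        ((-1 : Kq K) ^ r * qbin K (d i) (1 - A i j).toNat r) •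
          (ι (Kq K) (EGen.Y i) ^ ((1 - A i j).toNat - r) * ι (Kq K) (EGen.Y j) *
            ι (Kq K) (EGen.Y i) ^ r))
      ((∏ s ∈ Finset.range ((-(A i j)).toNat + 1), (1 - qi K (d i) ^ (A i j + 2 * (s : ℤ)))) •
        (ι (Kq K) (EGen.Xinv i) ^ (1 - A i j).toNat * ι (Kq K) (EGen.Xinv j)))
  | E8 (i j : Fin n) (hij : i ≠ j) : ERel K A d
      (∑ r ∈ Finset.range ((1 - A i j).toNat + 1),
        ((-1 : Kq K) ^ r * qbin K (d i) (1 - A i j).toNat r) •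
          (ι (Kq K) (EGen.Z i) ^ ((1 - A i j).toNat - r) * ι (Kq K) (EGen.Z j) *
            ι (Kq K) (EGen.Z i) ^ r))
      ((∏ s ∈ Finset.range ((-(A i j)).toNat + 1), (1 - qi K (d i) ^ (A i j + 2 * (s : ℤ)))) •
        (ι (Kq K) (EGen.Xinv i) ^ (1 - A i j).toNat * ι (Kq K) (EGen.Xinv j)))

/-- The equitable algebra `U` presented by generators and relations (E1)–(E8). -/
abbrev Ueqg (K : Type) [Field K] {n : ℕ} (A : Matrix (Fin n) (Fin n) ℤ) (d : Fin n → ℕ) :=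
  RingQuot (ERel K A d)

def genX (i : Fin n) : Ueqg K A d := RingQuot.mkAlgHom (Kq K) (ERel K A d) (ι (Kq K) (EGen.X i))
def genXinv (i : Fin n) : Ueqg K A d :=
  RingQuot.mkAlgHom (Kq K) (ERel K A d) (ι (Kq K) (EGen.Xinv i))
def genY (i : Fin n) : Ueqg K A d := RingQuot.mkAlgHom (Kq K) (ERel K A d) (ι (Kq K) (EGen.Y i))
def genZ (i : Fin n) : Ueqg K A d := RingQuot.mkAlgHom (Kq K) (ERel K A d) (ι (Kq K) (EGen.Z i))

/-- `A` is a symmetrizable generalized Cartan matrix with symmetrizing positive,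
relatively prime integers `d_i`, and `n ≥ 1`. -/
def IsSymmetrizableGCM {n : ℕ} (A : Matrix (Fin n) (Fin n) ℤ) (d : Fin n → ℕ) : Prop :=
  0 < n ∧ (∀ i, A i i = 2) ∧ (∀ i j, i ≠ j → A i j ≤ 0) ∧
    (∀ i, 0 < d i) ∧ Finset.univ.gcd d = 1 ∧
    (∀ i j, (d i : ℤ) * A i j = (d j : ℤ) * A j i)

end

section SerreSum

variable (K : Type) [Field K]

theorem qi_ne_zero (e : ℕ) : qi K e ≠ 0 := pow_ne_zero _ RatFunc.X_ne_zero

theorem qi_pow_ne_one {e m : ℕ} (he : 0 < e) (hm : 0 < m) : qi K e ^ m ≠ 1 := by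
  rw [qi, qv, ← pow_mul, ← RatFunc.algebraMap_X, ← map_pow,
    ← map_one (algebraMap (Polynomial K) (RatFunc K))]
  intro h
  have h' := congrArg Polynomial.natDegree (RatFunc.algebraMap_injective K h)
  simp only [Polynomial.natDegree_X_pow, Polynomial.natDegree_one, mul_eq_zero] at h'
  omega

theorem qi_sub_inv_ne_zero {e : ℕ} (he : 0 < e) : qi K e - (qi K e)⁻¹ ≠ 0 := by
  intro h
  apply qi_pow_ne_one K he two_pos
  have h0 := qi_ne_zero K e
  field_simp at h
  linear_combination h

theorem qnum_ne_zero {e m : ℕ} (he : 0 < e) (hm : 0 < m) : qnum K e m ≠ 0 := by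
  refine div_ne_zero (fun h => qi_pow_ne_one K he (Nat.mul_pos two_pos hm) ?_)
    (qi_sub_inv_ne_zero K he)
  have h0 := pow_ne_zero m (qi_ne_zero K e)
  rw [zpow_neg, zpow_natCast] at h
  field_simp at h
  rw [mul_comm, pow_mul]
  linear_combination h

theorem qfac_ne_zero {e : ℕ} (he : 0 < e) (m : ℕ) : qfac K e m ≠ 0 := by
  induction m with
  | zero => simp [qfac]
  | succ m ih => exact mul_ne_zero (by exact_mod_cast qnum_ne_zero K he m.succ_pos) ih

theorem qnum_add (e : ℕ) (a b : ℤ) :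
    qnum K e (a + b) = qi K e ^ b * qnum K e a + qi K e ^ (-a) * qnum K e b := by
  have h0 := qi_ne_zero K e
  simp only [qnum, neg_add, zpow_add₀ h0, mul_div_assoc', ← add_div, zpow_neg]
  congr 1
  field_simp
  ring

theorem qbin_zero_right {e : ℕ} (he : 0 < e) (m : ℕ) : qbin K e m 0 = 1 := by
  simp [qbin, qfac, qfac_ne_zero K he m]

theorem qbin_self {e : ℕ} (he : 0 < e) (m : ℕ) : qbin K e m m = 1 := by
  simp [qbin, qfac, qfac_ne_zero K he m]

theorem qbin_symm {e m r : ℕ} (hr : r ≤ m) : qbin K e m (m - r) = qbin K e m r := by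
  rw [qbin, qbin, Nat.sub_sub_self hr, mul_comm]

/-- One of the two Pascal identities for Gaussian binomials. -/
theorem qbin_pascal {e : ℕ} (he : 0 < e) {m r : ℕ} (hr : r < m) :
    qbin K e (m + 1) (r + 1) =
      qi K e ^ (-((r : ℤ) + 1)) * qbin K e m (r + 1) + qi K e ^ ((m : ℤ) - r) * qbin K e m r := by
  obtain ⟨s, rfl⟩ : ∃ s, m = r + s + 1 := ⟨m - r - 1, by omega⟩
  have h1 : r + s + 1 + 1 - (r + 1) = s + 1 := by omega
  have h2 : r + s + 1 - (r + 1) = s := by omega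
  have h3 : r + s + 1 - r = s + 1 := by omega
  have hq := qnum_add K e ((r : ℤ) + 1) ((s : ℤ) + 1)
  have hr0 := qfac_ne_zero K he r
  have hs0 := qfac_ne_zero K he s
  have hr1 : qnum K e ((r : ℤ) + 1) ≠ 0 := by exact_mod_cast qnum_ne_zero K he r.succ_pos
  have hs1 : qnum K e ((s : ℤ) + 1) ≠ 0 := by exact_mod_cast qnum_ne_zero K he s.succ_pos
  rw [qbin, qbin, qbin, h1, h2, h3]
  have e1 : ((r + s + 1 : ℕ) : ℤ) - r = s + 1 := by push_cast; ring
  have e2 : ((r + s + 1 : ℕ) : ℤ) + 1 = r + 1 + (s + 1) := by push_cast; ring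
  rw [e1]
  simp only [qfac]
  rw [e2, hq]
  field_simp
  ring

/-- The other Pascal identity for Gaussian binomials. -/
theorem qbin_pascal' {e : ℕ} (he : 0 < e) {m r : ℕ} (hr : r < m) :
    qbin K e (m + 1) (r + 1) =
      (qi K e)⁻¹ ^ (-((r : ℤ) + 1)) * qbin K e m (r + 1) +
        (qi K e)⁻¹ ^ ((m : ℤ) - r) * qbin K e m r := by
  have h := qbin_pascal K he (m := m) (r := m - r - 1) (by omega)
  have h1 : m - r - 1 + 1 = m - r := by omega
  rw [h1, ← qbin_symm K (by omega : m - r ≤ m + 1), ← qbin_symm K (by omega : m - r ≤ m),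
    ← qbin_symm K (by omega : m - r - 1 ≤ m), show m + 1 - (m - r) = r + 1 by omega,
    show m - (m - r) = r by omega, show m - (m - r - 1) = r + 1 by omega] at h
  rw [h, inv_zpow', inv_zpow', add_comm,
    show (m : ℤ) - (m - r - 1 : ℕ) = - -((r : ℤ) + 1) by omega,
    show -(((m - r - 1 : ℕ) : ℤ) + 1) = -((m : ℤ) - r) by omega]

variable {F : Type*} [Field F] {B C : Type*} [Ring B] [Algebra F B] [Ring C] [Algebra F C]

/-- The iterated `q`-commutator
`∏_{s < k} (L_u - t p^{2s} R_u) v`, where `L_u`, `R_u` are left and right multiplication by `u`. -/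
def iterQComm (p t : F) (u v : B) : ℕ → B
  | 0 => v
  | k + 1 => u * iterQComm p t u v k - (t * p ^ (2 * k)) • (iterQComm p t u v k * u)

theorem iterQComm_eq_sum {p t : F} (hp : p ≠ 0) {β : ℕ → ℕ → F} (h0 : ∀ m, β m 0 = 1)
    (h1 : ∀ m, β m m = 1)
    (hβ : ∀ m r, r < m → β (m + 1) (r + 1) =
      p ^ (-((r : ℤ) + 1)) * β m (r + 1) + p ^ ((m : ℤ) - r) * β m r) (u v : B) (k : ℕ) :
    iterQComm p t u v k = ∑ r ∈ Finset.range (k + 1),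
      ((-1) ^ r * t ^ r * p ^ ((r : ℤ) * (k - 1)) * β k r) • (u ^ (k - r) * v * u ^ r) := by
  induction k with
  | zero => simp [iterQComm, h0]
  | succ k ih =>
    have hL : u * iterQComm p t u v k = u ^ (k + 1) * v + ∑ r ∈ Finset.range k,
        ((-1) ^ (r + 1) * t ^ (r + 1) * p ^ ((r + 1 : ℤ) * (k - 1)) * β k (r + 1)) •
          (u ^ (k - r) * v * u ^ (r + 1)) := by
      rw [ih, Finset.sum_range_succ', mul_add, Finset.mul_sum, add_comm]
      congr 1
      · simp [h0, pow_succ', mul_assoc]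
      · refine Finset.sum_congr rfl fun r hr => ?_
        rw [Finset.mem_range] at hr
        rw [mul_smul_comm, ← mul_assoc, ← mul_assoc, ← pow_succ',
          show k - (r + 1) + 1 = k - r by omega]
        push_cast
        rfl
    have hR : (t * p ^ (2 * k)) • (iterQComm p t u v k * u) = ∑ r ∈ Finset.range k,
        (t * p ^ (2 * k) * ((-1) ^ r * t ^ r * p ^ ((r : ℤ) * (k - 1)) * β k r)) •
          (u ^ (k - r) * v * u ^ (r + 1)) +
        (t * p ^ (2 * k) * ((-1) ^ k * t ^ k * p ^ ((k : ℤ) * (k - 1)))) •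
          (v * u ^ (k + 1)) := by
      rw [ih, Finset.sum_range_succ, add_mul, smul_add, Finset.sum_mul, Finset.smul_sum]
      congr 1
      · refine Finset.sum_congr rfl fun r _ => ?_
        rw [smul_mul_assoc, smul_smul, mul_assoc _ (u ^ r), ← pow_succ]
      · rw [smul_mul_assoc, smul_smul, mul_assoc _ (u ^ k), ← pow_succ, h1]
        simp
    rw [iterQComm, hL, hR, Finset.sum_range_succ', Finset.sum_range_succ, add_comm (_ * v),
      add_sub_add_comm, ← Finset.sum_sub_distrib, sub_eq_add_neg (_ * v), add_comm (_ * v),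
      ← add_assoc]
    congr 1
    · congr 1
      · refine Finset.sum_congr rfl fun r hr => ?_
        rw [Finset.mem_range] at hr
        rw [← sub_smul, Nat.add_sub_add_right, hβ k r hr]
        congr 1
        have e1 : p ^ (((r + 1 : ℕ) : ℤ) * ((k + 1 : ℕ) - 1)) * p ^ (-((r : ℤ) + 1)) =
            p ^ ((r + 1 : ℤ) * (k - 1)) := by
          rw [← zpow_add₀ hp]; congr 1; push_cast; ring
        have e2 : p ^ (((r + 1 : ℕ) : ℤ) * ((k + 1 : ℕ) - 1)) * p ^ ((k : ℤ) - r) =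
            p ^ (2 * k) * p ^ ((r : ℤ) * (k - 1)) := by
          rw [← zpow_natCast p (2 * k), ← zpow_add₀ hp, ← zpow_add₀ hp]
          congr 1; push_cast; ring
        linear_combination (-(-1) ^ (r + 1) * t ^ (r + 1) * β k (r + 1)) * e1 -
          ((-1) ^ (r + 1) * t ^ (r + 1) * β k r) * e2
      · rw [h1, ← neg_smul, Nat.sub_self, pow_zero, one_mul]
        congr 1
        have e : p ^ (((k + 1 : ℕ) : ℤ) * ((k + 1 : ℕ) - 1)) =
            p ^ (2 * k) * p ^ ((k : ℤ) * (k - 1)) := by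
          rw [← zpow_natCast p (2 * k), ← zpow_add₀ hp]
          congr 1; push_cast; ring
        rw [e]
        ring
    · simp [h0]

/-- The alternating sum `∑ (-1)^r [m choose r]_i u^{m-r} v u^r` of the quantum Serre relations. -/
noncomputable def serreSum {B : Type*} [Ring B] [Algebra (Kq K) B] (e m : ℕ) (u v : B) : B :=
  ∑ r ∈ Finset.range (m + 1), ((-1 : Kq K) ^ r * qbin K e m r) • (u ^ (m - r) * v * u ^ r)

variable [Algebra (Kq K) B] [Algebra (Kq K) C]

theorem map_serreSum (f : B →ₐ[Kq K] C) (e m : ℕ) (u v : B) :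
    f (serreSum K e m u v) = serreSum K e m (f u) (f v) := by
  simp [serreSum, map_sum, map_smul]

theorem serreSum_zero (e m : ℕ) (u : B) : serreSum K e m u 0 = 0 := by
  simp [serreSum]

theorem serreSum_add_right (e m : ℕ) (u v w : B) :
    serreSum K e m u (v + w) = serreSum K e m u v + serreSum K e m u w := by
  simp [serreSum, mul_add, add_mul, Finset.sum_add_distrib]

theorem serreSum_eq_iterQComm {e : ℕ} (he : 0 < e) (m : ℕ) (u v : B) :
    serreSum K e m u v = iterQComm (qi K e) (qi K e ^ (1 - m : ℤ)) u v m := by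
  have hp := qi_ne_zero K e
  rw [iterQComm_eq_sum hp (qbin_zero_right K he) (qbin_self K he) fun _ _ => qbin_pascal K he]
  refine Finset.sum_congr rfl fun r _ => ?_
  congr 1
  have h : (qi K e ^ (1 - m : ℤ)) ^ r * qi K e ^ ((r : ℤ) * (m - 1)) = 1 := by
    rw [← zpow_natCast, ← zpow_mul, ← zpow_add₀ hp, ← zpow_zero (qi K e)]
    congr 1; ring
  linear_combination (-(-1) ^ r * qbin K e m r) * h

theorem serreSum_eq_iterQComm_inv {e : ℕ} (he : 0 < e) (m : ℕ) (u v : B) :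
    serreSum K e m u v = iterQComm (qi K e)⁻¹ (qi K e ^ (1 - m : ℤ))⁻¹ u v m := by
  have hp := inv_ne_zero (qi_ne_zero K e)
  rw [iterQComm_eq_sum hp (qbin_zero_right K he) (qbin_self K he) fun _ _ => qbin_pascal' K he,
    ← inv_zpow]
  refine Finset.sum_congr rfl fun r _ => ?_
  congr 1
  have h : ((qi K e)⁻¹ ^ (1 - m : ℤ)) ^ r * (qi K e)⁻¹ ^ ((r : ℤ) * (m - 1)) = 1 := by
    rw [← zpow_natCast, ← zpow_mul, ← zpow_add₀ hp, ← zpow_zero (qi K e)⁻¹]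
    congr 1; ring
  linear_combination (-(-1) ^ r * qbin K e m r) * h

theorem iterQComm_add_left {p t : F} {a b v : B} (hba : b * a = p ^ 2 • (a * b))
    (hbv : b * v = t • (v * b)) (k : ℕ) :
    iterQComm p t (a + b) v k = iterQComm p t a v k := by
  have hb : ∀ k, b * iterQComm p t a v k = (t * p ^ (2 * k)) • (iterQComm p t a v k * b) := by
    intro k
    induction k with
    | zero => simpa [iterQComm] using hbv
    | succ k ih =>
      rw [iterQComm, mul_sub, ← mul_assoc, hba, mul_smul_comm, ← mul_assoc b, ih, smul_mul_assoc,
        mul_assoc a, ih, smul_mul_assoc, mul_assoc _ b, hba]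
      simp only [mul_smul_comm, smul_mul_assoc, smul_smul, sub_mul, smul_sub, mul_assoc]
      congr 2 <;> ring
  induction k with
  | zero => rfl
  | succ k ih =>
    rw [iterQComm, ih, iterQComm, add_mul, hb, mul_add, smul_add]
    abel

theorem serreSum_add {e m : ℕ} (he : 0 < e) {a a' b b' : B}
    (hba : b * a = qi K e ^ 2 • (a * b)) (hba' : b * a' = qi K e ^ (1 - m : ℤ) • (a' * b))
    (hab' : b' * a = qi K e ^ (1 - m : ℤ) • (a * b')) :
    serreSum K e m (a + b) (a' + b') = serreSum K e m a a' + serreSum K e m b b' := by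
  have hp := qi_ne_zero K e
  rw [serreSum_add_right]
  congr 1
  · simp only [serreSum_eq_iterQComm K he]
    exact iterQComm_add_left hba hba' m
  · simp only [serreSum_eq_iterQComm_inv K he, add_comm a b]
    refine iterQComm_add_left ?_ ?_ m
    · rw [hba, smul_smul, ← mul_pow, inv_mul_cancel₀ hp, one_pow, one_smul]
    · rw [hab', smul_smul, inv_mul_cancel₀ (zpow_ne_zero _ hp), one_smul]

theorem iterQComm_of_commute {p t : F} {u v : B} (h : Commute u v) (k : ℕ) :
    iterQComm p t u v k = (∏ s ∈ Finset.range k, (1 - t * p ^ (2 * s))) • (u ^ k * v) := by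
  induction k with
  | zero => simp [iterQComm]
  | succ k ih =>
    have hc : u ^ k * v * u = u * (u ^ k * v) := by
      rw [mul_assoc, ← h.eq, ← mul_assoc, ← mul_assoc, ← pow_succ, ← pow_succ']
    rw [iterQComm, ih, mul_smul_comm, smul_mul_assoc, hc, smul_smul, ← sub_smul,
      Finset.prod_range_succ, pow_succ', mul_assoc u]
    congr 1
    ring

theorem serreSum_of_commute {e : ℕ} (he : 0 < e) (m : ℕ) {u v : B} (h : Commute u v) :
    serreSum K e m u v =
      (∏ s ∈ Finset.range m, (1 - qi K e ^ (1 - m + 2 * s : ℤ))) • (u ^ m * v) := by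
  have hp := qi_ne_zero K e
  rw [serreSum_eq_iterQComm K he, iterQComm_of_commute h]
  congr 1
  refine Finset.prod_congr rfl fun s _ => ?_
  rw [zpow_add₀ hp, ← zpow_natCast _ (2 * s)]
  push_cast
  rfl

theorem iterQComm_tmul {p t : F} {u v : B} {g h : C} (hgh : Commute g h) (k : ℕ) :
    iterQComm p t (u ⊗ₜ[F] g) (v ⊗ₜ[F] h) k = iterQComm p t u v k ⊗ₜ[F] (g ^ k * h) := by
  induction k with
  | zero => simp [iterQComm]
  | succ k ih =>
    have hc : g ^ k * h * g = g ^ (k + 1) * h := by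
      rw [mul_assoc, ← hgh.eq, ← mul_assoc, ← pow_succ]
    rw [iterQComm, ih, iterQComm, Algebra.TensorProduct.tmul_mul_tmul,
      Algebra.TensorProduct.tmul_mul_tmul, hc, ← mul_assoc, ← pow_succ',
      TensorProduct.sub_tmul, TensorProduct.smul_tmul']

theorem serreSum_tmul {e : ℕ} (he : 0 < e) (m : ℕ) {u v : B} {g h : C} (hgh : Commute g h) :
    serreSum K e m (u ⊗ₜ[Kq K] g) (v ⊗ₜ[Kq K] h) =
      serreSum K e m u v ⊗ₜ[Kq K] (g ^ m * h) := by
  simp only [serreSum_eq_iterQComm K he, iterQComm_tmul hgh]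

open MulOpposite in
theorem iterQComm_op {p t a b : F} (hp : p ≠ 0) (ht : t ≠ 0) {u v g h : B}
    (hgu : g * u = a • (u * g)) (hgv : g * v = b • (v * g)) (hhu : h * u = b • (u * h))
    (hgh : Commute g h) (k : ℕ) :
    ∃ c : F, iterQComm p t (op (-(u * g))) (op (-(v * h))) k =
      c • op (iterQComm p⁻¹ t⁻¹ u v k * (g ^ k * h)) := by
  induction k with
  | zero => exact ⟨-1, by simp [iterQComm]⟩
  | succ k ih =>
    obtain ⟨c, hc⟩ := ih
    set W := iterQComm p⁻¹ t⁻¹ u v with hW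
    have hgW : ∀ k, g * W k = (a ^ k * b) • (W k * g) := by
      intro k
      induction k with
      | zero => simpa [hW, iterQComm] using hgv
      | succ k ih =>
        change g * (u * W k - _ • (W k * u)) = _ • ((u * W k - _ • (W k * u)) * g)
        rw [mul_sub, ← mul_assoc, hgu, mul_smul_comm, ← mul_assoc g, ih, smul_mul_assoc,
          mul_assoc u, ih, smul_mul_assoc, mul_assoc _ g, hgu]
        simp only [mul_smul_comm, smul_mul_assoc, smul_smul, sub_mul, smul_sub, mul_assoc]
        congr 2 <;> ring
    have hgku : ∀ k, g ^ k * h * u = (a ^ k * b) • (u * (g ^ k * h)) := by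
      intro k
      induction k with
      | zero => simpa using hhu
      | succ k ih =>
        rw [pow_succ', mul_assoc g, mul_assoc g, ih, mul_smul_comm, ← mul_assoc, hgu,
          smul_mul_assoc, smul_smul, mul_assoc u]
        congr 1
        ring
    have hgg : g ^ k * h * g = g ^ (k + 1) * h := by
      rw [mul_assoc, ← hgh.eq, ← mul_assoc, ← pow_succ]
    refine ⟨c * (a ^ k * b) * (t * p ^ (2 * k)), ?_⟩
    have h1 : W k * (g ^ k * h) * (u * g) = (a ^ k * b) • (W k * u * (g ^ (k + 1) * h)) := by
      rw [mul_assoc, ← mul_assoc _ u, hgku, ← hgg]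
      simp only [mul_smul_comm, smul_mul_assoc, mul_assoc]
    have h2 : u * g * (W k * (g ^ k * h)) = (a ^ k * b) • (u * W k * (g ^ (k + 1) * h)) := by
      rw [mul_assoc, ← mul_assoc g, hgW, pow_succ']
      simp only [mul_smul_comm, smul_mul_assoc, mul_assoc]
    have h3 : W (k + 1) =
      u * W k - (t⁻¹ * p⁻¹ ^ (2 * k)) • (W k * u) := rfl
    rw [iterQComm, hc, mul_smul_comm, smul_mul_assoc, ← op_mul, ← op_mul, mul_neg, neg_mul, h1, h2,
      h3]
    simp only [← op_smul, ← op_sub]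
    congr 1
    rw [sub_mul, smul_sub, smul_neg, smul_neg, smul_neg, sub_neg_eq_add, smul_mul_assoc]
    simp only [smul_smul]
    rw [neg_add_eq_sub]
    congr 2
    · ring
    · rw [inv_pow]
      field_simp

open MulOpposite in
theorem serreSum_op_eq_zero {e m : ℕ} (he : 0 < e) {a b : Kq K} {u v g h : B}
    (hgu : g * u = a • (u * g)) (hgv : g * v = b • (v * g)) (hhu : h * u = b • (u * h))
    (hgh : Commute g h) (huv : serreSum K e m u v = 0) :
    serreSum K e m (op (-(u * g))) (op (-(v * h))) = 0 := by
  have hp := qi_ne_zero K e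
  rw [serreSum_eq_iterQComm K he]
  obtain ⟨c, hc⟩ := iterQComm_op hp (zpow_ne_zero (1 - m : ℤ) hp) hgu hgv hhu hgh m
  rw [hc, ← serreSum_eq_iterQComm_inv K he, huv, zero_mul, op_zero, smul_zero]

end SerreSum

section Equitable

variable (K : Type) [Field K] {n : ℕ} (A : Matrix (Fin n) (Fin n) ℤ) (d : Fin n → ℕ)
  {B C : Type*} [Ring B] [Algebra (Kq K) B] [Ring C] [Algebra (Kq K) C]

/-- Families `x`, `x' = x⁻¹`, `y`, `z` in an algebra such that the `x i` commute and the `y i`, `z i`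
are weight vectors of weight `-α_i`, `α_i` for conjugation by them. -/
structure IsWeightFamily (x x' y z : Fin n → B) : Prop where
  mul_inv (i) : x i * x' i = 1
  inv_mul (i) : x' i * x i = 1
  comm (i j) : Commute (x i) (x j)
  y_mul_x (i j) : y i * x j = qi K (d i) ^ A i j • (x j * y i)
  x_mul_z (i j) : x i * z j = qi K (d i) ^ A i j • (z j * x i)

/-- Families `x`, `x' = x⁻¹`, `y`, `z` in an algebra satisfying the relations of
`K_i`, `K_i⁻¹`, `(q_i - q_i⁻¹) F_i` and `-q_i (q_i - q_i⁻¹) K_i⁻¹ E_i` in `U_q(g)`. -/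
structure IsChevalleyFamily (x x' y z : Fin n → B) : Prop extends
    IsWeightFamily K A d x x' y z where
  z_mul_y_self (i) : z i * y i = qi K (d i) ^ 2 • (y i * z i) +
    (1 - qi K (d i) ^ 2) • (1 - x' i * x' i)
  z_mul_y (i j) (hij : i ≠ j) : z i * y j = qi K (d i) ^ A i j • (y j * z i)
  serre_y (i j) (hij : i ≠ j) : serreSum K (d i) (1 - A i j).toNat (y i) (y j) = 0
  serre_z (i j) (hij : i ≠ j) : serreSum K (d i) (1 - A i j).toNat (z i) (z j) = 0

variable {K A d}

theorem IsSymmetrizableGCM.qi_zpow_symm (hA : IsSymmetrizableGCM A d) (i j : Fin n) :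
    qi K (d i) ^ A i j = qi K (d j) ^ A j i := by
  simp only [qi, ← zpow_natCast, ← zpow_mul, hA.2.2.2.2.2 i j]

theorem IsSymmetrizableGCM.one_sub_toNat (hA : IsSymmetrizableGCM A d) {i j : Fin n}
    (hij : i ≠ j) : (1 - (1 - A i j).toNat : ℤ) = A i j := by
  have := hA.2.2.1 i j hij
  omega

theorem IsSymmetrizableGCM.qi_zpow_self (hA : IsSymmetrizableGCM A d) (i : Fin n) :
    qi K (d i) ^ A i i = qi K (d i) ^ 2 := by
  rw [hA.2.1 i]
  norm_cast

theorem IsSymmetrizableGCM.pos (hA : IsSymmetrizableGCM A d) (i : Fin n) : 0 < d i :=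
  hA.2.2.2.1 i

namespace IsWeightFamily

variable {x x' y z : Fin n → B}

theorem inv_mul_y (h : IsWeightFamily K A d x x' y z) (hA : IsSymmetrizableGCM A d)
    (i j : Fin n) : x' i * y j = qi K (d i) ^ A i j • (y j * x' i) := by
  calc x' i * y j = x' i * (y j * x i) * x' i := by simp only [mul_assoc, h.mul_inv, mul_one]
    _ = _ := by
      rw [h.y_mul_x, mul_smul_comm, ← mul_assoc, h.inv_mul, one_mul, smul_mul_assoc,
        hA.qi_zpow_symm i j]

theorem z_mul_inv (h : IsWeightFamily K A d x x' y z) (hA : IsSymmetrizableGCM A d)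
    (i j : Fin n) : z i * x' j = qi K (d i) ^ A i j • (x' j * z i) := by
  calc z i * x' j = x' j * (x j * z i) * x' j := by
        rw [← mul_assoc, h.inv_mul, one_mul]
    _ = _ := by
      rw [h.x_mul_z, mul_smul_comm, smul_mul_assoc, mul_assoc, mul_assoc, h.mul_inv, mul_one,
        hA.qi_zpow_symm i j]

theorem comm_inv (h : IsWeightFamily K A d x x' y z) (i j : Fin n) : Commute (x i) (x' j) := by
  have := (h.comm i j).eq
  calc x i * x' j = x' j * (x j * x i) * x' j := by rw [← mul_assoc, h.inv_mul, one_mul]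
    _ = x' j * x i := by rw [← this, mul_assoc, mul_assoc, h.mul_inv, mul_one]

theorem inv_comm (h : IsWeightFamily K A d x x' y z) (i j : Fin n) :
    Commute (x' i) (x' j) := by
  have := (h.comm_inv i j).eq
  calc x' i * x' j = x' i * (x' j * x i) * x' i := by
        rw [mul_assoc, mul_assoc, h.mul_inv, mul_one]
    _ = x' j * x' i := by rw [← this, ← mul_assoc, h.inv_mul, one_mul]

/-- The right-hand side of (E7) and (E8) is the Serre sum of `x_i⁻¹` and `x_j⁻¹`. -/
theorem serre_inv (h : IsWeightFamily K A d x x' y z) (hA : IsSymmetrizableGCM A d)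
    {i j : Fin n} (hij : i ≠ j) :
    serreSum K (d i) (1 - A i j).toNat (x' i) (x' j) =
      (∏ s ∈ Finset.range ((-(A i j)).toNat + 1), (1 - qi K (d i) ^ (A i j + 2 * (s : ℤ)))) •
        (x' i ^ (1 - A i j).toNat * x' j) := by
  have hle := hA.2.2.1 i j hij
  rw [serreSum_of_commute K (hA.pos i) _ (h.inv_comm i j), hA.one_sub_toNat hij,
    show (1 - A i j).toNat = (-(A i j)).toNat + 1 by omega]

theorem serre_y_add_inv (h : IsWeightFamily K A d x x' y z) (hA : IsSymmetrizableGCM A d)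
    {i j : Fin n} (hij : i ≠ j) :
    serreSum K (d i) (1 - A i j).toNat (y i + x' i) (y j + x' j) =
      serreSum K (d i) (1 - A i j).toNat (y i) (y j) +
        serreSum K (d i) (1 - A i j).toNat (x' i) (x' j) := by
  rw [serreSum_add K (hA.pos i)]
  · rw [h.inv_mul_y hA, hA.qi_zpow_self]
  · rw [h.inv_mul_y hA, hA.one_sub_toNat hij]
  · rw [h.inv_mul_y hA, hA.one_sub_toNat hij, hA.qi_zpow_symm]

theorem serre_z_add_inv (h : IsWeightFamily K A d x x' y z) (hA : IsSymmetrizableGCM A d)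
    {i j : Fin n} (hij : i ≠ j) :
    serreSum K (d i) (1 - A i j).toNat (z i + x' i) (z j + x' j) =
      serreSum K (d i) (1 - A i j).toNat (z i) (z j) +
        serreSum K (d i) (1 - A i j).toNat (x' i) (x' j) := by
  rw [add_comm (z i), add_comm (z j), serreSum_add K (hA.pos i), add_comm]
  · rw [h.z_mul_inv hA, hA.qi_zpow_self]
  · rw [h.z_mul_inv hA, hA.one_sub_toNat hij]
  · rw [h.z_mul_inv hA, hA.one_sub_toNat hij, hA.qi_zpow_symm]

theorem z_add_inv_mul_y_add_inv (h : IsWeightFamily K A d x x' y z) (hA : IsSymmetrizableGCM A d)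
    (i j : Fin n) :
    (z i + x' i) * (y j + x' j) - qi K (d i) ^ A i j • ((y j + x' j) * (z i + x' i)) =
      z i * y j - qi K (d i) ^ A i j • (y j * z i) +
        (1 - qi K (d i) ^ A i j) • (x' i * x' j) := by
  have h1 := (h.inv_comm i j).eq
  rw [add_mul, mul_add, mul_add, h.inv_mul_y hA, h.z_mul_inv hA, add_mul, mul_add, mul_add, h1]
  simp only [smul_add, sub_smul, one_smul]
  abel

end IsWeightFamily

namespace IsChevalleyFamily

variable {x x' y z : Fin n → B}

/-- The values on the equitable generators determined by a Chevalley family. -/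
def equitableGen (x x' y z : Fin n → B) : EGen n → B
  | .X i => x i
  | .Xinv i => x' i
  | .Y i => y i + x' i
  | .Z i => z i + x' i

theorem lift_eq_of_rel (h : IsChevalleyFamily K A d x x' y z) (hA : IsSymmetrizableGCM A d)
    ⦃a b : FreeAlgebra (Kq K) (EGen n)⦄ (hab : ERel K A d a b) :
    FreeAlgebra.lift (Kq K) (equitableGen x x' y z) a =
      FreeAlgebra.lift (Kq K) (equitableGen x x' y z) b := by
  cases hab with
  | E1a i => simpa [equitableGen] using h.mul_inv i
  | E1b i => simpa [equitableGen] using h.inv_mul i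
  | E2 i j => simpa [equitableGen] using (h.comm i j).eq
  | E3 i j =>
    simp only [map_sub, map_mul, map_smul, FreeAlgebra.lift_ι_apply, equitableGen]
    rw [add_mul, h.y_mul_x, mul_add, (h.comm_inv j i).eq]
    simp only [smul_add, sub_smul, one_smul]
    abel
  | E4 i j =>
    simp only [map_sub, map_mul, map_smul, FreeAlgebra.lift_ι_apply, equitableGen]
    rw [mul_add, h.x_mul_z, add_mul, (h.comm_inv i j).eq]
    simp only [smul_add, sub_smul, one_smul]
    abel
  | E5 i =>
    simp only [map_sub, map_mul, map_smul, map_one, FreeAlgebra.lift_ι_apply, equitableGen]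
    have := h.z_add_inv_mul_y_add_inv hA i i
    rw [hA.qi_zpow_self] at this
    rw [this, h.z_mul_y_self]
    simp only [sub_smul, one_smul, smul_sub]
    abel
  | E6 i j hij =>
    simp only [map_sub, map_mul, map_smul, FreeAlgebra.lift_ι_apply, equitableGen]
    rw [h.z_add_inv_mul_y_add_inv hA, h.z_mul_y i j hij, sub_self, zero_add]
  | E7 i j hij =>
    have := h.serre_y_add_inv hA hij
    rw [h.serre_y i j hij, zero_add, h.serre_inv hA hij] at this
    simpa [equitableGen, serreSum] using this
  | E8 i j hij =>
    have := h.serre_z_add_inv hA hij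
    rw [h.serre_z i j hij, zero_add, h.serre_inv hA hij] at this
    simpa [equitableGen, serreSum] using this

/-- The algebra homomorphism out of `U` determined by a Chevalley family. -/
noncomputable def lift (h : IsChevalleyFamily K A d x x' y z) (hA : IsSymmetrizableGCM A d) :
    Ueqg K A d →ₐ[Kq K] B :=
  RingQuot.liftAlgHom (Kq K) ⟨FreeAlgebra.lift (Kq K) (equitableGen x x' y z), h.lift_eq_of_rel hA⟩

section Lift

variable (h : IsChevalleyFamily K A d x x' y z) (hA : IsSymmetrizableGCM A d) (i : Fin n)

@[simp]
theorem lift_genX : h.lift hA (genX K A d i) = x i := by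
  simp [lift, genX, equitableGen]

@[simp]
theorem lift_genY : h.lift hA (genY K A d i) = y i + x' i := by
  simp [lift, genY, equitableGen]

@[simp]
theorem lift_genZ : h.lift hA (genZ K A d i) = z i + x' i := by
  simp [lift, genZ, equitableGen]

end Lift

end IsChevalleyFamily

theorem sub_mul_eq_smul_mul_sub {c : Kq K} {x y w : B} (hw : Commute w x)
    (h : y * x - c • (x * y) = (1 - c) • (w * x)) : (y - w) * x = c • (x * (y - w)) := by
  rw [sub_mul, mul_sub, smul_sub, ← hw.eq, sub_eq_sub_iff_sub_eq_sub, h, sub_smul, one_smul]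

theorem mul_sub_eq_smul_sub_mul {c : Kq K} {x z w : B} (hw : Commute w x)
    (h : x * z - c • (z * x) = (1 - c) • (x * w)) : x * (z - w) = c • ((z - w) * x) := by
  rw [sub_mul, mul_sub, smul_sub, hw.eq, sub_eq_sub_iff_sub_eq_sub, h, sub_smul, one_smul]

section Generators

variable (K A d) (i j : Fin n)

theorem genX_mul_genXinv : genX K A d i * genXinv K A d i = 1 := by
  simpa [genX, genXinv] using RingQuot.mkAlgHom_rel (Kq K) (ERel.E1a (K := K) (A := A) (d := d) i)

theorem genXinv_mul_genX : genXinv K A d i * genX K A d i = 1 := by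
  simpa [genX, genXinv] using RingQuot.mkAlgHom_rel (Kq K) (ERel.E1b (K := K) (A := A) (d := d) i)

theorem genK_mul_genKinv : genK K A d i * genKinv K A d i = 1 := by
  simpa [genK, genKinv] using RingQuot.mkAlgHom_rel (Kq K) (CRel.R1a (K := K) (A := A) (d := d) i)

theorem genKinv_mul_genK : genKinv K A d i * genK K A d i = 1 := by
  simpa [genK, genKinv] using RingQuot.mkAlgHom_rel (Kq K) (CRel.R1b (K := K) (A := A) (d := d) i)

theorem genX_comm : Commute (genX K A d i) (genX K A d j) := by
  simpa [genX, Commute, SemiconjBy] using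
    RingQuot.mkAlgHom_rel (Kq K) (ERel.E2 (K := K) (A := A) (d := d) i j)

theorem genXinv_comm_genX : Commute (genXinv K A d i) (genX K A d j) := by
  have h := (genX_comm K A d i j).eq
  calc genXinv K A d i * genX K A d j =
        genXinv K A d i * (genX K A d j * genX K A d i) * genXinv K A d i := by
        rw [mul_assoc, mul_assoc, genX_mul_genXinv, mul_one]
    _ = _ := by rw [← h, ← mul_assoc, genXinv_mul_genX, one_mul]

theorem isWeightFamily_gen :
    IsWeightFamily K A d (genX K A d) (genXinv K A d)
      (fun i => genY K A d i - genXinv K A d i) (fun i => genZ K A d i - genXinv K A d i) where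
  mul_inv i := genX_mul_genXinv K A d i
  inv_mul i := genXinv_mul_genX K A d i
  comm i j := genX_comm K A d i j
  y_mul_x i j := by
    refine sub_mul_eq_smul_mul_sub (genXinv_comm_genX K A d i j) ?_
    simpa [genX, genXinv, genY] using
      RingQuot.mkAlgHom_rel (Kq K) (ERel.E3 (K := K) (A := A) (d := d) i j)
  x_mul_z i j := by
    refine mul_sub_eq_smul_sub_mul (genXinv_comm_genX K A d j i) ?_
    simpa [genX, genXinv, genZ] using
      RingQuot.mkAlgHom_rel (Kq K) (ERel.E4 (K := K) (A := A) (d := d) i j)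

variable {A d} in
theorem isChevalleyFamily_gen (hA : IsSymmetrizableGCM A d) :
    IsChevalleyFamily K A d (genX K A d) (genXinv K A d)
      (fun i => genY K A d i - genXinv K A d i) (fun i => genZ K A d i - genXinv K A d i) where
  toIsWeightFamily := isWeightFamily_gen K A d
  z_mul_y_self i := by
    have h1 := (isWeightFamily_gen K A d).z_add_inv_mul_y_add_inv hA i i
    have h2 : genZ K A d i * genY K A d i - qi K (d i) ^ 2 • (genY K A d i * genZ K A d i) =
        (1 - qi K (d i) ^ 2) • 1 := by
      simpa [genY, genZ] using RingQuot.mkAlgHom_rel (Kq K) (ERel.E5 (K := K) (A := A) (d := d) i)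
    simp only [sub_add_cancel] at h1
    rw [hA.qi_zpow_self, h2, ← sub_eq_iff_eq_add] at h1
    rw [← sub_eq_iff_eq_add', ← h1, smul_sub]
  z_mul_y i j hij := by
    have h1 := (isWeightFamily_gen K A d).z_add_inv_mul_y_add_inv hA i j
    have h2 : genZ K A d i * genY K A d j - qi K (d i) ^ A i j • (genY K A d j * genZ K A d i) =
        (1 - qi K (d i) ^ A i j) • (genXinv K A d i * genXinv K A d j) := by
      simpa [genY, genZ, genXinv] using
        RingQuot.mkAlgHom_rel (Kq K) (ERel.E6 (K := K) (A := A) (d := d) i j hij)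
    simp only [sub_add_cancel] at h1
    rw [h2, right_eq_add, sub_eq_zero] at h1
    exact h1
  serre_y i j hij := by
    have h1 := (isWeightFamily_gen K A d).serre_y_add_inv hA hij
    have h2 := RingQuot.mkAlgHom_rel (Kq K) (ERel.E7 (K := K) (A := A) (d := d) i j hij)
    simp only [sub_add_cancel] at h1
    rw [(isWeightFamily_gen K A d).serre_inv hA hij] at h1
    rw [← right_eq_add.mp (Eq.trans _ h1)]
    simpa [serreSum, genY, genXinv] using h2.symm
  serre_z i j hij := by
    have h1 := (isWeightFamily_gen K A d).serre_z_add_inv hA hij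
    have h2 := RingQuot.mkAlgHom_rel (Kq K) (ERel.E8 (K := K) (A := A) (d := d) i j hij)
    simp only [sub_add_cancel] at h1
    rw [(isWeightFamily_gen K A d).serre_inv hA hij] at h1
    rw [← right_eq_add.mp (Eq.trans _ h1)]
    simpa [serreSum, genZ, genXinv] using h2.symm

end Generators

theorem IsChevalleyFamily.tmul {x x' y z : Fin n → B} {u u' v w : Fin n → C}
    (h : IsChevalleyFamily K A d x x' y z) (g : IsChevalleyFamily K A d u u' v w)
    (hA : IsSymmetrizableGCM A d) :
    IsChevalleyFamily K A d (fun i => x i ⊗ₜ[Kq K] u i) (fun i => x' i ⊗ₜ[Kq K] u' i)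
      (fun i => y i ⊗ₜ[Kq K] u' i + 1 ⊗ₜ[Kq K] v i)
      (fun i => z i ⊗ₜ[Kq K] u' i + 1 ⊗ₜ[Kq K] w i) where
  mul_inv i := by simp [h.mul_inv, g.mul_inv, Algebra.TensorProduct.one_def]
  inv_mul i := by simp [h.inv_mul, g.inv_mul, Algebra.TensorProduct.one_def]
  comm i j := by
    simp [Commute, SemiconjBy, (h.comm i j).eq, (g.comm i j).eq]
  y_mul_x i j := by
    simp only [add_mul, mul_add, Algebra.TensorProduct.tmul_mul_tmul, one_mul, mul_one,
      h.y_mul_x i j, g.y_mul_x i j, (g.comm_inv j i).eq, smul_add, TensorProduct.tmul_smul,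
      TensorProduct.smul_tmul']
  x_mul_z i j := by
    simp only [add_mul, mul_add, Algebra.TensorProduct.tmul_mul_tmul, one_mul, mul_one,
      h.x_mul_z i j, g.x_mul_z i j, (g.comm_inv i j).eq, smul_add, TensorProduct.tmul_smul,
      TensorProduct.smul_tmul']
  z_mul_y_self i := by
    have h1 := g.inv_mul_y hA i i
    have h2 := g.z_mul_inv hA i i
    rw [hA.qi_zpow_self] at h1 h2
    simp only [add_mul, mul_add, Algebra.TensorProduct.tmul_mul_tmul, one_mul, mul_one,
      h.z_mul_y_self i, g.z_mul_y_self i, h1, h2, smul_add, TensorProduct.tmul_smul,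
      TensorProduct.add_tmul, TensorProduct.tmul_add, TensorProduct.sub_tmul,
      TensorProduct.tmul_sub, ← TensorProduct.smul_tmul', smul_sub, sub_smul, one_smul,
      Algebra.TensorProduct.one_def]
    abel
  z_mul_y i j hij := by
    simp only [add_mul, mul_add, Algebra.TensorProduct.tmul_mul_tmul, one_mul, mul_one,
      h.z_mul_y i j hij, g.z_mul_y i j hij, g.inv_mul_y hA i j, g.z_mul_inv hA i j,
      (g.inv_comm i j).eq, smul_add, TensorProduct.tmul_smul, ← TensorProduct.smul_tmul']
    abel
  serre_y i j hij := by
    have h0 := map_serreSum K (Algebra.TensorProduct.includeRight : C →ₐ[Kq K] B ⊗[Kq K] C)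
      (d i) (1 - A i j).toNat (v i) (v j)
    rw [g.serre_y i j hij, map_zero] at h0
    simp only [Algebra.TensorProduct.includeRight_apply] at h0
    rw [add_comm, add_comm (y j ⊗ₜ[Kq K] u' j), serreSum_add K (hA.pos i), ← h0,
      serreSum_tmul K (hA.pos i) _ (g.inv_comm i j), h.serre_y i j hij, TensorProduct.zero_tmul,
      add_zero]
    · simp [g.inv_mul_y hA, hA.qi_zpow_self]
    · rw [hA.one_sub_toNat hij]
      simp [g.inv_mul_y hA]
    · rw [hA.one_sub_toNat hij, hA.qi_zpow_symm]
      simp [g.inv_mul_y hA]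
  serre_z i j hij := by
    have h0 := map_serreSum K (Algebra.TensorProduct.includeRight : C →ₐ[Kq K] B ⊗[Kq K] C)
      (d i) (1 - A i j).toNat (w i) (w j)
    rw [g.serre_z i j hij, map_zero] at h0
    simp only [Algebra.TensorProduct.includeRight_apply] at h0
    rw [serreSum_add K (hA.pos i), ← h0,
      serreSum_tmul K (hA.pos i) _ (g.inv_comm i j), h.serre_z i j hij, TensorProduct.zero_tmul,
      add_zero]
    · simp [g.z_mul_inv hA, hA.qi_zpow_self]
    · rw [hA.one_sub_toNat hij]
      simp [g.z_mul_inv hA]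
    · rw [hA.one_sub_toNat hij, hA.qi_zpow_symm]
      simp [g.z_mul_inv hA]

open MulOpposite in
theorem IsChevalleyFamily.op {x x' y z : Fin n → B}
    (h : IsChevalleyFamily K A d x x' y z) (hA : IsSymmetrizableGCM A d) :
    IsChevalleyFamily K A d (fun i => op (x' i)) (fun i => op (x i))
      (fun i => op (-(y i * x i))) (fun i => op (-(z i * x i))) where
  mul_inv i := by rw [← op_mul, h.mul_inv, op_one]
  inv_mul i := by rw [← op_mul, h.inv_mul, op_one]
  comm i j := (h.inv_comm i j).op
  y_mul_x i j := by
    rw [← op_mul, ← op_mul, ← op_smul, mul_neg, neg_mul, ← mul_assoc, h.inv_mul_y hA,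
      smul_mul_assoc, mul_assoc, mul_assoc, (h.comm_inv i j).eq, smul_neg, hA.qi_zpow_symm]
  x_mul_z i j := by
    rw [← op_mul, ← op_mul, ← op_smul, mul_neg, neg_mul, ← mul_assoc, mul_assoc,
      (h.comm_inv j i).eq, ← mul_assoc, h.z_mul_inv hA, smul_mul_assoc, smul_neg, hA.qi_zpow_symm]
  z_mul_y_self i := by
    have h1 := h.x_mul_z i i
    have h2 := h.y_mul_x i i
    rw [hA.qi_zpow_self] at h1 h2
    have h3 : y i * x i * (z i * x i) = qi K (d i) ^ 2 • (y i * z i * (x i * x i)) := by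
      rw [mul_assoc, ← mul_assoc (x i), h1]
      simp only [mul_smul_comm, smul_mul_assoc, mul_assoc]
    have h4 : qi K (d i) ^ 2 • (z i * x i * (y i * x i)) = z i * y i * (x i * x i) := by
      rw [mul_assoc, ← mul_smul_comm, ← mul_assoc (x i), ← smul_mul_assoc, ← h2]
      simp only [mul_assoc]
    have h5 : x' i * x' i * (x i * x i) = 1 := by
      rw [mul_assoc, ← mul_assoc (x' i) (x i), h.inv_mul, one_mul, h.inv_mul]
    simp only [← op_mul, ← op_smul, ← op_sub, ← op_add, ← op_one, neg_mul_neg]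
    rw [h3, h4, h.z_mul_y_self, add_mul, smul_mul_assoc, smul_mul_assoc, sub_mul, h5, one_mul]
    simp only [smul_sub]
    congr 1
    abel
  z_mul_y i j hij := by
    have h3 : y j * x j * (z i * x i) = qi K (d i) ^ A i j • (y j * z i * (x i * x j)) := by
      rw [mul_assoc, ← mul_assoc (x j), h.x_mul_z, (h.comm i j).eq, hA.qi_zpow_symm i j]
      simp only [mul_smul_comm, smul_mul_assoc, mul_assoc]
    have h4 : qi K (d i) ^ A i j • (z i * x i * (y j * x j)) = z i * y j * (x i * x j) := by
      rw [mul_assoc, ← mul_smul_comm, ← mul_assoc (x i), ← smul_mul_assoc, hA.qi_zpow_symm i j,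
        ← h.y_mul_x]
      simp only [mul_assoc]
    simp only [← op_mul, ← op_smul, neg_mul_neg]
    rw [h3, h4, h.z_mul_y i j hij, smul_mul_assoc]
  serre_y i j hij := by
    have hxy : ∀ i j, x j * y i = (qi K (d i) ^ A i j)⁻¹ • (y i * x j) := fun i j => by
      rw [h.y_mul_x, inv_smul_smul₀ (zpow_ne_zero _ (qi_ne_zero K _))]
    exact serreSum_op_eq_zero K (hA.pos i) (hxy i i) (hxy j i)
      (by rw [hxy, hA.qi_zpow_symm]) (h.comm i j) (h.serre_y i j hij)
  serre_z i j hij := by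
    exact serreSum_op_eq_zero K (hA.pos i) (h.x_mul_z i i) (h.x_mul_z i j)
      (by rw [h.x_mul_z, hA.qi_zpow_symm]) (h.comm i j) (h.serre_z i j hij)

variable (K) in
theorem isChevalleyFamily_trivial :
    IsChevalleyFamily K A d (fun _ => (1 : Kq K)) (fun _ => 1) (fun _ => 0) (fun _ => 0) where
  mul_inv _ := mul_one 1
  inv_mul _ := mul_one 1
  comm _ _ := Commute.all _ _
  y_mul_x _ _ := by simp
  x_mul_z _ _ := by simp
  z_mul_y_self _ := by simp
  z_mul_y _ _ _ := by simp
  serre_y _ _ _ := serreSum_zero K _ _ _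
  serre_z _ _ _ := serreSum_zero K _ _ _

end Equitable

section Comparison

variable {K : Type} [Field K] {n : ℕ} {A : Matrix (Fin n) (Fin n) ℤ} {d : Fin n → ℕ}
  {B : Type*} [Semiring B] [Algebra (Kq K) B]

/-- Algebra homomorphisms out of `U` agree if they agree on the `X_i`, `Y_i`, `Z_i`. -/
theorem Ueqg.algHom_ext {f g : Ueqg K A d →ₐ[Kq K] B}
    (hX : ∀ i, f (genX K A d i) = g (genX K A d i))
    (hY : ∀ i, f (genY K A d i) = g (genY K A d i))
    (hZ : ∀ i, f (genZ K A d i) = g (genZ K A d i)) : f = g := by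
  refine RingQuot.ringQuot_ext' (Kq K) f g (FreeAlgebra.hom_ext (funext fun t => ?_))
  cases t with
  | X i => exact hX i
  | Y i => exact hY i
  | Z i => exact hZ i
  | Xinv i =>
    refine left_inv_eq_right_inv (a := f (genX K A d i)) ?_ ?_
    · exact (map_mul f _ _).symm.trans ((congrArg f (genXinv_mul_genX K A d i)).trans (map_one f))
    · rw [hX]
      exact (map_mul g _ _).symm.trans ((congrArg g (genX_mul_genXinv K A d i)).trans (map_one g))

/-- An algebra homomorphism out of `U_q(g)` sends `K_i⁻¹` to the inverse of the image of `K_i`. -/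
theorem map_genKinv {f : Uqg K A d →ₐ[Kq K] B} {i : Fin n} {b : B}
    (hb : f (genK K A d i) * b = 1) : f (genKinv K A d i) = b :=
  left_inv_eq_right_inv (a := f (genK K A d i))
    (by rw [← map_mul, genKinv_mul_genK, map_one]) hb

end Comparison

open MulOpposite in
/-- There exist a comultiplication `Δ`, counit `ε`, and antipode `S`
(an antihomomorphism, formalized as an algebra homomorphism `U → Uᵐᵒᵖ`) on the equitable
algebra `U`, given on generators by the stated formulas; under the isomorphism
`θ : U → U_q(g)` they correspond to the standard comultiplication, counit and antipode
of `U_q(g)`. -/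
theorem equitable_hopf_structure (K : Type) [Field K] {n : ℕ}
    (A : Matrix (Fin n) (Fin n) ℤ) (d : Fin n → ℕ) (hA : IsSymmetrizableGCM A d) :
    ∃ (Δ : Ueqg K A d →ₐ[Kq K] (Ueqg K A d ⊗[Kq K] Ueqg K A d))
      (ε : Ueqg K A d →ₐ[Kq K] Kq K) (S : Ueqg K A d →ₐ[Kq K] (Ueqg K A d)ᵐᵒᵖ),
      (∀ i : Fin n,
        Δ (genX K A d i) = genX K A d i ⊗ₜ[Kq K] genX K A d i ∧
        Δ (genY K A d i) =
          (genY K A d i - 1) ⊗ₜ[Kq K] genXinv K A d i + 1 ⊗ₜ[Kq K] genY K A d i ∧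
        Δ (genZ K A d i) =
          (genZ K A d i - 1) ⊗ₜ[Kq K] genXinv K A d i + 1 ⊗ₜ[Kq K] genZ K A d i ∧
        ε (genX K A d i) = 1 ∧ ε (genY K A d i) = 1 ∧ ε (genZ K A d i) = 1 ∧
        S (genX K A d i) = op (genXinv K A d i) ∧
        S (genY K A d i) = op (1 + genX K A d i - genY K A d i * genX K A d i) ∧
        S (genZ K A d i) = op (1 + genX K A d i - genZ K A d i * genX K A d i)) ∧
      (∀ (θ : Ueqg K A d ≃ₐ[Kq K] Uqg K A d)
          (Δstd : Uqg K A d →ₐ[Kq K] (Uqg K A d ⊗[Kq K] Uqg K A d))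
          (εstd : Uqg K A d →ₐ[Kq K] Kq K)
          (Sstd : Uqg K A d →ₐ[Kq K] (Uqg K A d)ᵐᵒᵖ),
        (∀ i : Fin n,
          θ (genX K A d i) = genK K A d i ∧
          θ (genXinv K A d i) = genKinv K A d i ∧
          θ (genY K A d i) =
            genKinv K A d i + (qi K (d i) - (qi K (d i))⁻¹) • genF K A d i ∧
          θ (genZ K A d i) = genKinv K A d i -
            (qi K (d i) * (qi K (d i) - (qi K (d i))⁻¹)) •
              (genKinv K A d i * genE K A d i)) →
        (∀ i : Fin n,
          Δstd (genE K A d i) =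
            genE K A d i ⊗ₜ[Kq K] 1 + genK K A d i ⊗ₜ[Kq K] genE K A d i ∧
          Δstd (genF K A d i) =
            genF K A d i ⊗ₜ[Kq K] genKinv K A d i + 1 ⊗ₜ[Kq K] genF K A d i ∧
          Δstd (genK K A d i) = genK K A d i ⊗ₜ[Kq K] genK K A d i ∧
          εstd (genE K A d i) = 0 ∧ εstd (genF K A d i) = 0 ∧ εstd (genK K A d i) = 1 ∧
          Sstd (genE K A d i) = op (-(genKinv K A d i * genE K A d i)) ∧
          Sstd (genF K A d i) = op (-(genF K A d i * genK K A d i)) ∧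
          Sstd (genK K A d i) = op (genKinv K A d i)) →
        (Algebra.TensorProduct.map θ.toAlgHom θ.toAlgHom).comp Δ = Δstd.comp θ.toAlgHom ∧
        ε = εstd.comp θ.toAlgHom ∧
        ∀ u : Ueqg K A d, θ (unop (S u)) = unop (Sstd (θ u))) := by
  have hU := isChevalleyFamily_gen K hA
  refine ⟨(hU.tmul hU hA).lift hA, (isChevalleyFamily_trivial K).lift hA, (hU.op hA).lift hA,
    fun i => ⟨?_, ?_, ?_, ?_, ?_, ?_, ?_, ?_, ?_⟩, fun θ Δstd εstd Sstd hθ hstd => ?_⟩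
  · simp
  · simp only [IsChevalleyFamily.lift_genY, TensorProduct.sub_tmul, TensorProduct.tmul_sub]
    abel
  · simp only [IsChevalleyFamily.lift_genZ, TensorProduct.sub_tmul, TensorProduct.tmul_sub]
    abel
  · simp
  · simp
  · simp
  · simp
  · rw [IsChevalleyFamily.lift_genY, sub_mul, genXinv_mul_genX, ← op_add]
    congr 1
    abel
  · rw [IsChevalleyFamily.lift_genZ, sub_mul, genXinv_mul_genX, ← op_add]
    congr 1
    abel
  choose hθX hθX' hθY hθZ using hθ
  choose hΔE hΔF hΔK hεE hεF hεK hSE hSF hSK using hstd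
  have hΔK' (i) : Δstd (genKinv K A d i) = genKinv K A d i ⊗ₜ genKinv K A d i :=
    map_genKinv (by simp [hΔK, genK_mul_genKinv, Algebra.TensorProduct.one_def])
  have hεK' (i) : εstd (genKinv K A d i) = 1 := map_genKinv (by simp [hεK])
  have hSK' (i) : Sstd (genKinv K A d i) = op (genK K A d i) :=
    map_genKinv (by rw [hSK, ← op_mul, genK_mul_genKinv, op_one])
  refine ⟨Ueqg.algHom_ext (fun i => ?_) (fun i => ?_) (fun i => ?_),
    Ueqg.algHom_ext (fun i => ?_) (fun i => ?_) (fun i => ?_), fun u => ?_⟩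
  · simp [hθX, hΔK]
  · simp [hθX', hθY, hΔK', hΔF, TensorProduct.tmul_smul, ← TensorProduct.smul_tmul', add_comm]
  · simp [hθX', hθZ, hΔK', hΔE, TensorProduct.tmul_neg, TensorProduct.neg_tmul,
      TensorProduct.tmul_smul, ← TensorProduct.smul_tmul', genKinv_mul_genK, mul_add]
    abel
  · simp [hθX, hεK]
  · simp [hθY, hεK', hεF]
  · simp [hθZ, hεK', hεE]
  · have hS : (AlgHom.op θ.toAlgHom).comp ((hU.op hA).lift hA) = Sstd.comp θ.toAlgHom := by
      refine Ueqg.algHom_ext (fun i => ?_) (fun i => ?_) (fun i => ?_)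
      · simp [hθX, hθX', hSK]
      · simp [hθX, hθX', hθY, hSK', hSF, add_comm]
      · simp [hθX, hθX', hθZ, hSK', hSE, sub_eq_add_neg, add_comm]
        exact (congrArg _ (smul_neg _ _).symm).trans (mul_smul_comm _ _ _)
    exact congrArg unop (DFunLike.congr_fun hS u)
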